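/- Under the AGM-BiO iteration with arbitrary positive step sizes a_k > 0, for every k ≥ 0 it holds that A_{k+1}(g(x_{k+1}) − g(x*)) − A_k(g(x_k) − g(x*)) ≤ a_k (g_k − g(x*)) + ( L_g a_k² / (2 A_{k+1}) ) ‖z_{k+1} − z_k‖². -/

import Mathlib

open RealInnerProductSpace

section Gradient

variable {E : Type*} [NormedAddCommGroup E] [InnerProductSpace ℝ E] [CompleteSpace E]
  {g : E → ℝ} {g' : E → E}

theorem HasGradientAt.hasDerivAt_comp_add_smul {G u d : E} {t : ℝ}
    (h : HasGradientAt g G (u + t • d)) :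
    HasDerivAt (fun s : ℝ => g (u + s • d)) ⟪G, d⟫ t := by
  have hline : HasDerivAt (fun s : ℝ => u + s • d) d t := by
    simpa using ((hasDerivAt_id t).smul_const d).const_add u
  simpa [Function.comp_def] using h.hasFDerivAt.comp_hasDerivAt t hline

/-- The first-order lower bound for a convex function. -/
theorem ConvexOn.add_inner_gradient_le {G u : E} (hg : ConvexOn ℝ Set.univ g)
    (h : HasGradientAt g G u) (v : E) : g u + ⟪G, v - u⟫ ≤ g v := by
  have hder : HasDerivAt (fun s : ℝ => g (u + s • (v - u))) ⟪G, v - u⟫ 0 :=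
    HasGradientAt.hasDerivAt_comp_add_smul (by simpa using h)
  have hconv : ConvexOn ℝ Set.univ (fun s : ℝ => g (u + s • (v - u))) := by
    have := hg.comp_affineMap (AffineMap.lineMap u v : ℝ →ᵃ[ℝ] E)
    simpa [Function.comp_def, AffineMap.lineMap_apply, add_comm] using this
  have := hconv.le_slope_of_hasDerivAt (Set.mem_univ 0) (Set.mem_univ 1) one_pos hder
  simp [slope_def_field] at this
  linarith

/-- The descent lemma: a function with `L`-Lipschitz gradient has a quadratic upper bound. -/
theorem le_add_inner_gradient_add_sq {L : ℝ} (hg' : ∀ w, HasGradientAt g (g' w) w)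
    (hL : ∀ u v, ‖g' u - g' v‖ ≤ L * ‖u - v‖) (u v : E) :
    g v ≤ g u + ⟪g' u, v - u⟫ + L / 2 * ‖v - u‖ ^ 2 := by
  set d := v - u with hd
  have hder (t : ℝ) : HasDerivAt
      (fun s : ℝ => g (u + s • d) - (s * ⟪g' u, d⟫ + s ^ 2 * (L / 2 * ‖d‖ ^ 2)))
      (⟪g' (u + t • d), d⟫ - (⟪g' u, d⟫ + 2 * t * (L / 2 * ‖d‖ ^ 2))) t := by
    refine (hg' _).hasDerivAt_comp_add_smul.sub (HasDerivAt.add ?_ ?_)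
    · simpa using (hasDerivAt_id t).mul_const ⟪g' u, d⟫
    · simpa using (hasDerivAt_pow 2 t).mul_const (L / 2 * ‖d‖ ^ 2)
  have hanti := antitoneOn_of_hasDerivWithinAt_nonpos (convex_Icc (0 : ℝ) 1)
    (fun t _ => (hder t).continuousAt.continuousWithinAt)
    (fun t _ => (hder t).hasDerivWithinAt) (fun t ht => by
      rw [interior_Icc] at ht
      have hlip := hL (u + t • d) u
      rw [add_sub_cancel_left, norm_smul, Real.norm_of_nonneg ht.1.le] at hlip
      have hcs := real_inner_le_norm (g' (u + t • d) - g' u) d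
      rw [inner_sub_left] at hcs
      nlinarith [mul_le_mul_of_nonneg_right hlip (norm_nonneg d)])
  have := hanti (Set.left_mem_Icc.2 zero_le_one) (Set.right_mem_Icc.2 zero_le_one) zero_le_one
  simp [hd] at this
  linarith

end Gradient



theorem agm_bio_potential_g
    {n : ℕ} {f g : EuclideanSpace ℝ (Fin n) → ℝ}
    {f' g' : EuclideanSpace ℝ (Fin n) → EuclideanSpace ℝ (Fin n)}
    {Z : Set (EuclideanSpace ℝ (Fin n))}
    {L_f L_g : ℝ} (hLf : 0 < L_f) (hLg : 0 < L_g)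
    (hZconv : Convex ℝ Z) (hZcl : IsClosed Z)
    (hfconv : ConvexOn ℝ Set.univ f) (hgconv : ConvexOn ℝ Set.univ g)
    (hf' : ∀ w, HasGradientAt f (f' w) w)
    (hg' : ∀ w, HasGradientAt g (g' w) w)
    (hLipf : ∀ u v, ‖f' u - f' v‖ ≤ L_f * ‖u - v‖)
    (hLipg : ∀ u v, ‖g' u - g' v‖ ≤ L_g * ‖u - v‖)
    {xstar : EuclideanSpace ℝ (Fin n)}
    (hxZ : xstar ∈ Z)
    (hxlow : ∀ w ∈ Z, g xstar ≤ g w)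
    (hxopt : ∀ w ∈ Z, (∀ u ∈ Z, g w ≤ g u) → f xstar ≤ f w)
    {x z y : ℕ → EuclideanSpace ℝ (Fin n)} {A a gs : ℕ → ℝ}
    (hA0 : A 0 = 0) (hxz0 : x 0 = z 0)
    (ha : ∀ k, 0 < a k)
    (hArec : ∀ k, A (k + 1) = A k + a k)
    (hy : ∀ k, y k = (A k / (A k + a k)) • x k + (a k / (A k + a k)) • z k)
    (hgs : ∀ k, g xstar ≤ gs k)
    (hzmem : ∀ k, z (k + 1) ∈ Z ∧ g (y k) + ⟪g' (y k), z (k + 1) - y k⟫ ≤ gs k)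
    (hzproj : ∀ k, ∀ w ∈ Z, g (y k) + ⟪g' (y k), w - y k⟫ ≤ gs k →
        ‖z (k + 1) - (z k - a k • f' (y k))‖ ≤ ‖w - (z k - a k • f' (y k))‖)
    (hxrec : ∀ k, x (k + 1) = (A k / (A k + a k)) • x k + (a k / (A k + a k)) • z (k + 1)) :
    ∀ k : ℕ,
      A (k + 1) * (g (x (k + 1)) - g xstar) - A k * (g (x k) - g xstar) ≤
        a k * (gs k - g xstar) + L_g * a k ^ 2 / (2 * A (k + 1)) * ‖z (k + 1) - z k‖ ^ 2 := by
  intro k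
  have hA (j : ℕ) : 0 ≤ A j := by
    induction j with
    | zero => exact hA0.ge
    | succ j ih => rw [hArec]; linarith [ha j]
  have hak := ha k
  have hAk := hA k
  have hpos : 0 < A k + a k := by linarith
  have hdiff : x (k + 1) - y k = (a k / (A k + a k)) • (z (k + 1) - z k) := by
    rw [hxrec, hy, smul_sub]
    abel
  have hcomb : (A k + a k) • (x (k + 1) - y k) = A k • (x k - y k) + a k • (z (k + 1) - y k) := by
    rw [smul_sub, hxrec, smul_add, smul_smul, smul_smul, mul_div_cancel₀ _ hpos.ne',
      mul_div_cancel₀ _ hpos.ne']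
    module
  have hinner := congrArg (fun w => ⟪g' (y k), w⟫) hcomb
  simp only [inner_add_right, real_inner_smul_right] at hinner
  have hdescent := le_add_inner_gradient_add_sq hg' hLipg (y k) (x (k + 1))
  have hlower := mul_le_mul_of_nonneg_left (hgconv.add_inner_gradient_le (hg' (y k)) (x k)) hAk
  have hcut := mul_le_mul_of_nonneg_left (hzmem k).2 hak.le
  have hupper := mul_le_mul_of_nonneg_left hdescent hpos.le
  have hquad : (A k + a k) * (L_g / 2 * ‖x (k + 1) - y k‖ ^ 2) =
      L_g * a k ^ 2 / (2 * (A k + a k)) * ‖z (k + 1) - z k‖ ^ 2 := by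
    rw [hdiff, norm_smul, Real.norm_of_nonneg (by positivity)]
    field_simp
  rw [hArec]
  linarith
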